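/- Dirichlet form comparison: assume that for every D ⊆ J̃ the matrix R′^D − R^D is positive semidefinite in L²(ξ^D), i.e. Σ_{j∈J̃₀∖D} ξ^D_j u_j Σ_{i∈J̃₀∖D} (r′^D_{ji} − r^D_{ji}) u_i ≥ 0 for every vector u = (u_j)_{j∈J̃₀∖D}. Then for every square-summable f : Ẽ → ℝ one has ⟨f, −Q^Z f⟩_π̃ ≥ ⟨f, −Q^{Z′} f⟩_π̃. -/

import Mathlib

open scoped BigOperators

noncomputable section

namespace UnrelNet

/-- State space of the unreliable Jackson network: a set of broken-down nodes
together with a queue-length vector. -/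
abbrev Est (J : ℕ) := Finset (Fin J) × (Fin J → ℕ)

/-- The extended node set `J̃₀ ∖ D`: the exterior node `none` together with
the up nodes (complement of `D`). -/
def ext (J : ℕ) (D : Finset (Fin J)) : Finset (Option (Fin J)) :=
  insert none (Dᶜ.image Option.some)

/-- Unit vector `e_j` of `ℕ^J̃`, with `e_0 = 0` (index `none`). -/
def eV {J : ℕ} (o : Option (Fin J)) : Fin J → ℕ := fun i =>
  match o with
  | none => 0
  | some j => if i = j then 1 else 0

/-- Breakdown/repair generator `Q^Y`. -/
def QY {J : ℕ} (A B : Finset (Fin J) → ℝ) (f : Finset (Fin J) → ℝ)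
    (D : Finset (Fin J)) : ℝ :=
  (∑ H ∈ Finset.univ.filter (fun H => H ⊂ D), B D / B H * (f H - f D))
    + ∑ I ∈ Finset.univ.filter (fun I => D ⊂ I), A I / A D * (f I - f D)

/-- Off-diagonal breakdown/repair rates. -/
def qY0 {J : ℕ} (A B : Finset (Fin J) → ℝ) (D E : Finset (Fin J)) : ℝ :=
  if D ⊂ E then A E / A D else if E ⊂ D then B D / B E else 0

/-- Breakdown/repair rate matrix `q^Y`, including the diagonal. -/
def qY {J : ℕ} (A B : Finset (Fin J) → ℝ) (D E : Finset (Fin J)) : ℝ :=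
  if E = D then -∑ F, qY0 A B D F else qY0 A B D E

/-- Breakdown/repair generator written via the rate matrix. -/
def QYm {J : ℕ} (A B : Finset (Fin J) → ℝ) (f : Finset (Fin J) → ℝ)
    (D : Finset (Fin J)) : ℝ :=
  ∑ E, qY A B D E * f E

/-- Normalisation constant `Ĉ`. -/
def Chat {J : ℕ} (A B : Finset (Fin J) → ℝ) : ℝ := ∑ D, A D / B D

/-- Stationary distribution `π̂` of the breakdown/repair process. -/
def piY {J : ℕ} (A B : Finset (Fin J) → ℝ) (D : Finset (Fin J)) : ℝ :=
  (A D / B D) / Chat A B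

/-- `Π_{i=1}^{k} η_j/μ_j(i)`. -/
def prodK {J : ℕ} (η : Fin J → ℝ) (μ : Fin J → ℕ → ℝ) (j : Fin J) (k : ℕ) : ℝ :=
  ∏ i ∈ Finset.range k, η j / μ j (i + 1)

/-- Normalisation constant `C_j`. -/
def Cnorm {J : ℕ} (η : Fin J → ℝ) (μ : Fin J → ℕ → ℝ) (j : Fin J) : ℝ :=
  ∑' k : ℕ, prodK η μ j k

/-- Product-form stationary distribution `π` of the Jackson network. -/
def piX {J : ℕ} (η : Fin J → ℝ) (μ : Fin J → ℕ → ℝ) (n : Fin J → ℕ) : ℝ :=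
  ∏ j, prodK η μ j (n j) / Cnorm η μ j

/-- Product measure `π̃(D,n) = π̂(D)·π(n)`. -/
def piZ {J : ℕ} (η : Fin J → ℝ) (μ : Fin J → ℕ → ℝ) (A B : Finset (Fin J) → ℝ)
    (x : Est J) : ℝ :=
  piY A B x.1 * piX η μ x.2

/-- Generator `Q^Z` of the unreliable Jackson network. -/
def QZ {J : ℕ} (lam : ℝ) (μ : Fin J → ℕ → ℝ)
    (r : Finset (Fin J) → Option (Fin J) → Option (Fin J) → ℝ)
    (A B : Finset (Fin J) → ℝ) (f : Est J → ℝ) (x : Est J) : ℝ :=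
  (∑ j ∈ x.1ᶜ, lam * r x.1 none (some j) * (f (x.1, x.2 + eV (some j)) - f x))
    + (∑ j ∈ x.1ᶜ, μ j (x.2 j) * r x.1 (some j) none * (f (x.1, x.2 - eV (some j)) - f x))
    + (∑ j ∈ x.1ᶜ, ∑ i ∈ x.1ᶜ,
        μ j (x.2 j) * r x.1 (some j) (some i) * (f (x.1, x.2 - eV (some j) + eV (some i)) - f x))
    + (∑ H ∈ Finset.univ.filter (fun H => H ⊂ x.1), B x.1 / B H * (f (H, x.2) - f x))
    + ∑ I ∈ Finset.univ.filter (fun I => x.1 ⊂ I), A I / A x.1 * (f (I, x.2) - f x)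

/-- Transition-rate matrix `q^Z` of the unreliable Jackson network
(between distinct states; the diagonal is set to `0`). -/
def qZ {J : ℕ} (lam : ℝ) (μ : Fin J → ℕ → ℝ)
    (r : Finset (Fin J) → Option (Fin J) → Option (Fin J) → ℝ)
    (A B : Finset (Fin J) → ℝ) (x y : Est J) : ℝ :=
  if x = y then 0
  else
    (if y.1 = x.1 then
        ∑ j ∈ x.1ᶜ,
          ((if y.2 = x.2 + eV (some j) then lam * r x.1 none (some j) else 0)
            + (if y.2 + eV (some j) = x.2 then μ j (x.2 j) * r x.1 (some j) none else 0)
            + ∑ i ∈ x.1ᶜ,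
                if i ≠ j ∧ y.2 + eV (some j) = x.2 + eV (some i) then
                  μ j (x.2 j) * r x.1 (some j) (some i)
                else 0)
      else 0)
    + (if y.2 = x.2 then
        (if y.1 ⊂ x.1 then B x.1 / B y.1 else 0) + (if x.1 ⊂ y.1 then A y.1 / A x.1 else 0)
      else 0)

/-- Extension `η^D` of the traffic solution: `η^D_0 = λ`, `η^D_j = η_j`. -/
def etaE {J : ℕ} (lam : ℝ) (η : Fin J → ℝ) : Option (Fin J) → ℝ := fun o => o.elim lam η

/-- Normalised routing-equilibrium vector `ξ^D`. -/
def xiV {J : ℕ} (lam : ℝ) (η : Fin J → ℝ) (D : Finset (Fin J))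
    (o : Option (Fin J)) : ℝ :=
  etaE lam η o / ∑ k ∈ ext J D, etaE lam η k

/-- Spectral gap of a generator on the network state space w.r.t. a measure `m`. -/
def GapZ {J : ℕ} (m : Est J → ℝ) (Q : (Est J → ℝ) → Est J → ℝ) : ℝ :=
  sInf {v : ℝ | ∃ f : Est J → ℝ,
    Summable (fun x => f x * f x * m x) ∧ (∑' x, f x * m x) = 0 ∧
      (∑' x, f x * f x * m x) = 1 ∧ v = ∑' x, f x * -(Q f x) * m x}

/-- Spectral gap of a generator on `2^{J̃}` w.r.t. a probability vector `m`. -/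
def GapY {J : ℕ} (m : Finset (Fin J) → ℝ)
    (Q : (Finset (Fin J) → ℝ) → Finset (Fin J) → ℝ) : ℝ :=
  sInf {v : ℝ | ∃ f : Finset (Fin J) → ℝ,
    (∑ D, m D * f D) = 0 ∧ (∑ D, m D * f D ^ 2) = 1 ∧
      v = -(∑ D, m D * f D * Q f D)}

/-- Merge a vector indexed by `D` with a vector indexed by `J̃∖D`. -/
def merge {J : ℕ} (D : Finset (Fin J)) (a : {j : Fin J // j ∈ D} → ℕ)
    (b : {j : Fin J // j ∉ D} → ℕ) : Fin J → ℕ := fun j =>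
  if h : j ∈ D then a ⟨j, h⟩ else b ⟨j, h⟩

/-- Marginal product-form density on a sub-collection of nodes. -/
def piSub {J : ℕ} (η : Fin J → ℝ) (μ : Fin J → ℕ → ℝ) (p : Fin J → Prop)
    [DecidablePred p] (a : {j : Fin J // p j} → ℕ) : ℝ :=
  ∏ j : {j : Fin J // p j}, prodK η μ j.1 (a j) / Cnorm η μ j.1

/-- Unit vector on a subtype index set. -/
def eS {J : ℕ} {p : Fin J → Prop} (j : {k : Fin J // p k}) :
    {k : Fin J // p k} → ℕ := fun i => if i = j then 1 else 0

/-- Generator of the synthetic subnetwork on the up nodes `J̃∖D`. -/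
def QXsub {J : ℕ} (lam : ℝ) (μ : Fin J → ℕ → ℝ)
    (r : Finset (Fin J) → Option (Fin J) → Option (Fin J) → ℝ)
    (D : Finset (Fin J)) (h : ({j : Fin J // j ∉ D} → ℕ) → ℝ)
    (m : {j : Fin J // j ∉ D} → ℕ) : ℝ :=
  (∑ j : {j : Fin J // j ∉ D}, lam * r D none (some j.1) * (h (m + eS j) - h m))
    + (∑ j : {j : Fin J // j ∉ D}, μ j.1 (m j) * r D (some j.1) none * (h (m - eS j) - h m))
    + ∑ j : {j : Fin J // j ∉ D}, ∑ i : {j : Fin J // j ∉ D},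
        μ j.1 (m j) * r D (some j.1) (some i.1) * (h (m - eS j + eS i) - h m)

/-- Transition-rate matrix `q^X` of the (reliable) Jackson network. -/
def qX {J : ℕ} (lam : ℝ) (μ : Fin J → ℕ → ℝ)
    (r : Option (Fin J) → Option (Fin J) → ℝ) (n m : Fin J → ℕ) : ℝ :=
  if n = m then 0
  else
    ∑ j : Fin J,
      ((if m = n + eV (some j) then lam * r none (some j) else 0)
        + (if m + eV (some j) = n then μ j (n j) * r (some j) none else 0)
        + ∑ i : Fin J,
            if i ≠ j ∧ m + eV (some j) = n + eV (some i) then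
              μ j (n j) * r (some j) (some i)
            else 0)

/-- One-step Markov operator `K = Id + ε·Q`. -/
def Kop {J : ℕ} (ε : ℝ) (Q : (Est J → ℝ) → Est J → ℝ) :
    (Est J → ℝ) → Est J → ℝ := fun h x => h x + ε * Q h x

def rt {J : ℕ} (lam : ℝ) (μ : Fin J → ℕ → ℝ) (o : Option (Fin J)) (n : Fin J → ℕ) : ℝ :=
  o.elim lam (fun j => μ j (n j))

lemma eV_none {J : ℕ} : (eV (none : Option (Fin J))) = 0 := rfl

lemma sum_ext {J : ℕ} (D : Finset (Fin J)) (h : Option (Fin J) → ℝ) :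
    ∑ o ∈ ext J D, h o = h none + ∑ j ∈ Dᶜ, h (some j) := by
  unfold ext
  rw [Finset.sum_insert (by simp), Finset.sum_image (by simp)]

lemma QZ_eq {J : ℕ} (lam : ℝ) (μ : Fin J → ℕ → ℝ)
    (r : Finset (Fin J) → Option (Fin J) → Option (Fin J) → ℝ)
    (hrsto : ∀ D : Finset (Fin J), ∀ i ∈ ext J D, ∑ j ∈ ext J D, r D i j = 1)
    (A B : Finset (Fin J) → ℝ) (f : Est J → ℝ) (x : Est J) :
    QZ lam μ r A B f x =
      (∑ i ∈ ext J x.1, ∑ j ∈ ext J x.1,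
        r x.1 i j * (rt lam μ i x.2 * f (x.1, x.2 - eV i + eV j)))
      - (∑ i ∈ ext J x.1, rt lam μ i x.2) * f x
      + (∑ H ∈ Finset.univ.filter (fun H => H ⊂ x.1), B x.1 / B H * (f (H, x.2) - f x))
      + ∑ I ∈ Finset.univ.filter (fun I => x.1 ⊂ I), A I / A x.1 * (f (I, x.2) - f x) := by
  have h1 : (∑ i ∈ ext J x.1, rt lam μ i x.2) * f x =
      ∑ i ∈ ext J x.1, ∑ j ∈ ext J x.1, r x.1 i j * (rt lam μ i x.2 * f x) := by
    rw [Finset.sum_mul]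
    refine Finset.sum_congr rfl fun i hi => ?_
    rw [← Finset.sum_mul, hrsto _ _ hi, one_mul]
  have h2 : (∑ i ∈ ext J x.1, ∑ j ∈ ext J x.1,
        r x.1 i j * (rt lam μ i x.2 * f (x.1, x.2 - eV i + eV j)))
      - (∑ i ∈ ext J x.1, rt lam μ i x.2) * f x =
      ∑ i ∈ ext J x.1, ∑ j ∈ ext J x.1,
        rt lam μ i x.2 * r x.1 i j * (f (x.1, x.2 - eV i + eV j) - f x) := by
    rw [h1, ← Finset.sum_sub_distrib]
    refine Finset.sum_congr rfl fun i _ => ?_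
    rw [← Finset.sum_sub_distrib]
    refine Finset.sum_congr rfl fun j _ => ?_
    ring
  rw [h2]
  unfold QZ
  congr 2
  simp only [sum_ext, eV_none, rt, Option.elim_none, Option.elim_some, add_zero, tsub_zero,
    Finset.sum_add_distrib, Prod.mk.eta, sub_self, mul_zero, zero_add]
  ring

lemma prodK_nonneg {J : ℕ} (η : Fin J → ℝ) (μ : Fin J → ℕ → ℝ)
    (hμpos : ∀ j k, k ≠ 0 → 0 < μ j k) (hη : ∀ j, 0 < η j) (j : Fin J) (k : ℕ) :
    0 ≤ prodK η μ j k :=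
  Finset.prod_nonneg fun i _ => (div_pos (hη j) (hμpos j _ (Nat.succ_ne_zero i))).le

lemma piX_nonneg {J : ℕ} (η : Fin J → ℝ) (μ : Fin J → ℕ → ℝ)
    (hμpos : ∀ j k, k ≠ 0 → 0 < μ j k) (hη : ∀ j, 0 < η j) (n : Fin J → ℕ) :
    0 ≤ piX η μ n :=
  Finset.prod_nonneg fun j _ => div_nonneg (prodK_nonneg η μ hμpos hη _ _)
    (tsum_nonneg fun k => prodK_nonneg η μ hμpos hη _ _)

lemma balance {J : ℕ} (lam : ℝ) (η : Fin J → ℝ) (μ : Fin J → ℕ → ℝ)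
    (hμpos : ∀ j k, k ≠ 0 → 0 < μ j k) (i : Option (Fin J)) (m : Fin J → ℕ) :
    rt lam μ i (m + eV i) * piX η μ (m + eV i) = etaE lam η i * piX η μ m := by
  cases i with
  | none => simp [rt, etaE, eV_none]
  | some k =>
    have hk : (m + eV (some k)) k = m k + 1 := by simp [eV]
    have h3 : ∏ j ∈ Finset.univ.erase k, prodK η μ j ((m + eV (some k)) j) / Cnorm η μ j
        = ∏ j ∈ Finset.univ.erase k, prodK η μ j (m j) / Cnorm η μ j := by
      refine Finset.prod_congr rfl fun j hj => ?_
      have : (m + eV (some k)) j = m j := by simp [eV, Finset.ne_of_mem_erase hj]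
      rw [this]
    unfold piX
    rw [← Finset.mul_prod_erase _ _ (Finset.mem_univ k),
      ← Finset.mul_prod_erase _ (fun j => prodK η μ j (m j) / Cnorm η μ j) (Finset.mem_univ k), h3]
    simp only [rt, etaE, Option.elim_some, hk]
    have := (hμpos k (m k + 1) (Nat.succ_ne_zero _)).ne'
    have h4 : prodK η μ k (m k + 1) = prodK η μ k (m k) * (η k / μ k (m k + 1)) := by
      unfold prodK
      rw [Finset.prod_range_succ]
    have h5 : μ k (m k + 1) * prodK η μ k (m k + 1) = η k * prodK η μ k (m k) := by
      rw [h4]; field_simp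
    calc _ = (μ k (m k + 1) * prodK η μ k (m k + 1)) / Cnorm η μ k *
        ∏ j ∈ Finset.univ.erase k, prodK η μ j (m j) / Cnorm η μ j := by ring
      _ = _ := by rw [h5]; ring

lemma shift_inj {J : ℕ} (i : Option (Fin J)) :
    Function.Injective (fun m : Fin J → ℕ => m + eV i) := fun _ _ h => add_right_cancel h

lemma rt_zero {J : ℕ} (lam : ℝ) (μ : Fin J → ℕ → ℝ) (hμ0 : ∀ j, μ j 0 = 0)
    (i : Option (Fin J)) (n : Fin J → ℕ)
    (hn : n ∉ Set.range (fun m : Fin J → ℕ => m + eV i)) : rt lam μ i n = 0 := by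
  cases i with
  | none => exact absurd ⟨n, by simp [eV_none]⟩ hn
  | some k =>
    by_cases h : n k = 0
    · simp [rt, h, hμ0]
    · refine absurd ⟨n - eV (some k), ?_⟩ hn
      funext j
      by_cases hj : j = k
      · subst hj; simp [eV]; omega
      · simp [eV, hj]

lemma summable_T {J : ℕ} (lam : ℝ) (hlam : 0 < lam) (η : Fin J → ℝ) (μ : Fin J → ℕ → ℝ)
    (hμ0 : ∀ j, μ j 0 = 0)
    (hμpos : ∀ j k, k ≠ 0 → 0 < μ j k) (hη : ∀ j, 0 < η j)
    (hμbdd : ∃ M : ℝ, ∀ j k, μ j k ≤ M)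
    (g : (Fin J → ℕ) → ℝ) (hg : Summable fun n => g n * g n * piX η μ n)
    (i : Option (Fin J)) :
    Summable fun m => piX η μ m * (g (m + eV i) * g (m + eV i)) := by
  obtain ⟨M, hM⟩ := hμbdd
  have hw := piX_nonneg η μ hμpos hη
  have hrt0 : ∀ n, 0 ≤ rt lam μ i n := by
    intro n
    cases i with
    | none => exact hlam.le
    | some k =>
      change 0 ≤ μ k (n k)
      by_cases h : n k = 0
      · rw [h, hμ0]
      · exact (hμpos k _ h).le
  have hrt : ∀ n, rt lam μ i n ≤ max lam M := by
    intro n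
    cases i with
    | none => exact le_max_left _ _
    | some k => exact (hM k (n k)).trans (le_max_right _ _)
  have he : 0 < etaE lam η i := by
    cases i with
    | none => exact hlam
    | some k => exact hη k
  have h1 : Summable fun n => rt lam μ i n * (g n * g n * piX η μ n) := by
    refine Summable.of_nonneg_of_le (fun n => ?_) (fun n => ?_) (hg.mul_left (max lam M))
    · exact mul_nonneg (hrt0 n) (mul_nonneg (mul_self_nonneg _) (hw n))
    · exact mul_le_mul_of_nonneg_right (hrt n) (mul_nonneg (mul_self_nonneg _) (hw n))
  have h2 := (h1.comp_injective (shift_inj i)).mul_left (etaE lam η i)⁻¹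
  refine h2.congr fun m => ?_
  have hb := balance lam η μ hμpos i m
  simp only [Function.comp]
  rw [inv_mul_eq_div, div_eq_iff he.ne']
  linear_combination (g (m + eV i) * g (m + eV i)) * hb

lemma summable_T2 {J : ℕ} (lam : ℝ) (hlam : 0 < lam) (η : Fin J → ℝ) (μ : Fin J → ℕ → ℝ)
    (hμ0 : ∀ j, μ j 0 = 0)
    (hμpos : ∀ j k, k ≠ 0 → 0 < μ j k) (hη : ∀ j, 0 < η j)
    (hμbdd : ∃ M : ℝ, ∀ j k, μ j k ≤ M)
    (g : (Fin J → ℕ) → ℝ) (hg : Summable fun n => g n * g n * piX η μ n)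
    (i j : Option (Fin J)) :
    Summable fun m => piX η μ m * (g (m + eV i) * g (m + eV j)) := by
  have hw := piX_nonneg η μ hμpos hη
  refine Summable.of_norm_bounded
    ((summable_T lam hlam η μ hμ0 hμpos hη hμbdd g hg i).add
      (summable_T lam hlam η μ hμ0 hμpos hη hμbdd g hg j)) fun m => ?_
  rw [Real.norm_eq_abs, abs_mul, abs_of_nonneg (hw m), ← mul_add]
  refine mul_le_mul_of_nonneg_left ?_ (hw m)
  rw [abs_le]
  constructor <;> nlinarith [sq_nonneg (g (m + eV i) + g (m + eV j)),
    sq_nonneg (g (m + eV i) - g (m + eV j)), sq_nonneg (g (m + eV i)), sq_nonneg (g (m + eV j))]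

lemma hasSum_G {J : ℕ} (lam : ℝ) (hlam : 0 < lam) (η : Fin J → ℝ) (μ : Fin J → ℕ → ℝ)
    (hμ0 : ∀ j, μ j 0 = 0)
    (hμpos : ∀ j k, k ≠ 0 → 0 < μ j k) (hη : ∀ j, 0 < η j)
    (hμbdd : ∃ M : ℝ, ∀ j k, μ j k ≤ M)
    (g : (Fin J → ℕ) → ℝ) (hg : Summable fun n => g n * g n * piX η μ n)
    (i j : Option (Fin J)) :
    HasSum (fun n => g n * (rt lam μ i n * g (n - eV i + eV j)) * piX η μ n)
      (etaE lam η i * ∑' m, piX η μ m * (g (m + eV i) * g (m + eV j))) := by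
  rw [← (shift_inj i).hasSum_iff]
  · refine ((summable_T2 lam hlam η μ hμ0 hμpos hη hμbdd g hg i j).hasSum.mul_left
      (etaE lam η i)).congr_fun ?_
    intro m
    have hb := balance lam η μ hμpos i m
    simp only [Function.comp, add_tsub_cancel_right]
    linear_combination (g (m + eV i) * g (m + eV j)) * hb
  · intro n hn
    rw [rt_zero lam μ hμ0 i n hn]; ring

lemma hasSum_fin {J : ℕ} (h : Finset (Fin J) → (Fin J → ℕ) → ℝ) (S : Finset (Fin J) → ℝ)
    (hS : ∀ D, HasSum (h D) (S D)) :
    HasSum (fun x : Est J => h x.1 x.2) (∑ D, S D) := by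
  have h1 : (fun x : Est J => h x.1 x.2) =
      fun x : Est J => ∑ D : Finset (Fin J), if x.1 = D then h D x.2 else 0 := by
    funext x; simp
  rw [h1]
  refine hasSum_sum fun D _ => ?_
  have hi : Function.Injective (fun n : Fin J → ℕ => ((D, n) : Est J)) := fun a b hab => by
    simpa using hab
  rw [← hi.hasSum_iff]
  · simpa [Function.comp_def] using hS D
  · rintro ⟨E, n⟩ hx
    rw [if_neg]
    rintro rfl
    exact hx ⟨n, rfl⟩

/-- Dirichlet-form comparison.  If `R'^D − R^D` is positive
semidefinite in `L²(ξ^D)` for every `D`, then `⟨f,−Q^Z f⟩ ≥ ⟨f,−Q^{Z'} f⟩` for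
every square-summable `f`. -/
theorem dirichlet_form_comparison
    (J : ℕ) (hJ : 1 ≤ J)
    (lam : ℝ) (hlam : 0 < lam)
    (μ : Fin J → ℕ → ℝ)
    (hμ0 : ∀ j, μ j 0 = 0)
    (hμpos : ∀ j k, k ≠ 0 → 0 < μ j k)
    (hμbdd : ∃ M : ℝ, ∀ j k, μ j k ≤ M)
    (r : Finset (Fin J) → Option (Fin J) → Option (Fin J) → ℝ)
    (hrnn : ∀ D : Finset (Fin J), ∀ i ∈ ext J D, ∀ j ∈ ext J D, 0 ≤ r D i j)
    (hrsto : ∀ D : Finset (Fin J), ∀ i ∈ ext J D, ∑ j ∈ ext J D, r D i j = 1)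
    (η : Fin J → ℝ) (hη : ∀ j, 0 < η j)
    (htraffic : ∀ D : Finset (Fin J), ∀ j ∈ Dᶜ,
      η j = lam * r D none (some j) + ∑ i ∈ Dᶜ, η i * r D (some i) (some j))
    (r' : Finset (Fin J) → Option (Fin J) → Option (Fin J) → ℝ)
    (hrnn' : ∀ D : Finset (Fin J), ∀ i ∈ ext J D, ∀ j ∈ ext J D, 0 ≤ r' D i j)
    (hrsto' : ∀ D : Finset (Fin J), ∀ i ∈ ext J D, ∑ j ∈ ext J D, r' D i j = 1)
    (htraffic' : ∀ D : Finset (Fin J), ∀ j ∈ Dᶜ,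
      η j = lam * r' D none (some j) + ∑ i ∈ Dᶜ, η i * r' D (some i) (some j))
    (A B : Finset (Fin J) → ℝ)
    (hApos : ∀ D, 0 < A D) (hBpos : ∀ D, 0 < B D)
    (hA0 : A (∅ : Finset (Fin J)) = 1) (hB0 : B (∅ : Finset (Fin J)) = 1)
    (hC : ∀ j, Summable (fun k => prodK η μ j k))
    (hpsd : ∀ D : Finset (Fin J), ∀ u : Option (Fin J) → ℝ,
      0 ≤ ∑ j ∈ ext J D, xiV lam η D j * u j *
            ∑ i ∈ ext J D, (r' D j i - r D j i) * u i) :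
    ∀ f : Est J → ℝ, Summable (fun x : Est J => f x * f x * piZ η μ A B x) →
      (∑' x : Est J, f x * -(QZ lam μ r' A B f x) * piZ η μ A B x)
        ≤ ∑' x : Est J, f x * -(QZ lam μ r A B f x) * piZ η μ A B x := by
  intro f hf
  set G : Finset (Fin J) → Option (Fin J) → Option (Fin J) → (Fin J → ℕ) → ℝ :=
    fun D i j n => f (D, n) * (rt lam μ i n * f (D, n - eV i + eV j)) * piX η μ n with hG
  have hChat : 0 < Chat A B :=
    Finset.sum_pos (fun D _ => div_pos (hApos D) (hBpos D)) Finset.univ_nonempty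
  have hpY : ∀ D, 0 < piY A B D := fun D => div_pos (div_pos (hApos D) (hBpos D)) hChat
  have hw := piX_nonneg η μ hμpos hη
  have hg : ∀ D, Summable fun n => f (D, n) * f (D, n) * piX η μ n := by
    intro D
    have hi : Function.Injective (fun n : Fin J → ℕ => ((D, n) : Est J)) := fun a b hab => by
      simpa using hab
    refine ((hf.comp_injective hi).mul_left (piY A B D)⁻¹).congr fun n => ?_
    have := (hpY D).ne'
    simp only [Function.comp, piZ]
    field_simp
  set T : Finset (Fin J) → Option (Fin J) → Option (Fin J) → ℝ :=
    fun D i j => ∑' m, piX η μ m * (f (D, m + eV i) * f (D, m + eV j)) with hT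
  have hGs : ∀ D i j, HasSum (G D i j) (etaE lam η i * T D i j) := fun D i j =>
    hasSum_G lam hlam η μ hμ0 hμpos hη hμbdd (fun n => f (D, n)) (hg D) i j
  have hTs : ∀ D i j, HasSum (fun m => piX η μ m * (f (D, m + eV i) * f (D, m + eV j)))
      (T D i j) := fun D i j =>
    (summable_T2 lam hlam η μ hμ0 hμpos hη hμbdd (fun n => f (D, n)) (hg D) i j).hasSum
  have hdiff := hasSum_fin
    (fun D n => piY A B D * ∑ i ∈ ext J D, ∑ j ∈ ext J D, (r' D i j - r D i j) * G D i j n)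
    (fun D => piY A B D * ∑ i ∈ ext J D, ∑ j ∈ ext J D,
      (r' D i j - r D i j) * (etaE lam η i * T D i j))
    (fun D => HasSum.mul_left _ (hasSum_sum fun i _ => hasSum_sum fun j _ =>
      (hGs D i j).mul_left _))
  have hnn : 0 ≤ ∑ D, piY A B D * ∑ i ∈ ext J D, ∑ j ∈ ext J D,
      (r' D i j - r D i j) * (etaE lam η i * T D i j) := by
    refine Finset.sum_nonneg fun D _ => mul_nonneg (hpY D).le ?_
    have hs : HasSum (fun m => ∑ i ∈ ext J D, ∑ j ∈ ext J D,
        (r' D i j - r D i j) * (etaE lam η i *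
          (piX η μ m * (f (D, m + eV i) * f (D, m + eV j)))))
        (∑ i ∈ ext J D, ∑ j ∈ ext J D, (r' D i j - r D i j) * (etaE lam η i * T D i j)) :=
      hasSum_sum fun i _ => hasSum_sum fun j _ => ((hTs D i j).mul_left _).mul_left _
    refine hs.nonneg fun m => ?_
    have hp := hpsd D (fun o => f (D, m + eV o))
    have hZ : 0 < ∑ k ∈ ext J D, etaE lam η k := by
      rw [sum_ext]
      exact add_pos_of_pos_of_nonneg hlam (Finset.sum_nonneg fun j _ => (hη j).le)
    have : ∑ i ∈ ext J D, ∑ j ∈ ext J D,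
        (r' D i j - r D i j) * (etaE lam η i *
          (piX η μ m * (f (D, m + eV i) * f (D, m + eV j))))
        = (piX η μ m * ∑ k ∈ ext J D, etaE lam η k) *
          ∑ j ∈ ext J D, xiV lam η D j * f (D, m + eV j) *
            ∑ i ∈ ext J D, (r' D j i - r D j i) * f (D, m + eV i) := by
      have hx : ∀ i, etaE lam η i = xiV lam η D i * ∑ k ∈ ext J D, etaE lam η k := by
        intro i
        unfold xiV; rw [div_mul_cancel₀ _ hZ.ne']
      generalize (∑ k ∈ ext J D, etaE lam η k) = Z at hx
      rw [Finset.mul_sum]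
      refine Finset.sum_congr rfl fun i _ => ?_
      rw [Finset.mul_sum, Finset.mul_sum]
      refine Finset.sum_congr rfl fun j _ => ?_
      rw [hx]; ring
    rw [this]
    exact mul_nonneg (mul_nonneg (hw m) hZ.le) hp
  have key : ∀ x : Est J, f x * -(QZ lam μ r' A B f x) * piZ η μ A B x +
      piY A B x.1 * ∑ i ∈ ext J x.1, ∑ j ∈ ext J x.1, (r' x.1 i j - r x.1 i j) * G x.1 i j x.2
      = f x * -(QZ lam μ r A B f x) * piZ η μ A B x := by
    intro x
    rw [QZ_eq lam μ r hrsto, QZ_eq lam μ r' hrsto']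
    have : ∑ i ∈ ext J x.1, ∑ j ∈ ext J x.1, (r' x.1 i j - r x.1 i j) * G x.1 i j x.2
        = f x * ((∑ i ∈ ext J x.1, ∑ j ∈ ext J x.1,
            r' x.1 i j * (rt lam μ i x.2 * f (x.1, x.2 - eV i + eV j)))
          - ∑ i ∈ ext J x.1, ∑ j ∈ ext J x.1,
            r x.1 i j * (rt lam μ i x.2 * f (x.1, x.2 - eV i + eV j))) * piX η μ x.2 := by
      rw [← Finset.sum_sub_distrib, Finset.mul_sum, Finset.sum_mul]
      refine Finset.sum_congr rfl fun i _ => ?_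
      rw [← Finset.sum_sub_distrib, Finset.mul_sum, Finset.sum_mul]
      refine Finset.sum_congr rfl fun j _ => ?_
      simp only [hG, Prod.mk.eta]
      ring
    rw [this]
    unfold piZ
    ring
  by_cases hb : Summable fun x : Est J => f x * -(QZ lam μ r' A B f x) * piZ η μ A B x
  · have h := hb.hasSum.add hdiff
    simp only [key] at h
    rw [h.tsum_eq]
    linarith
  · have ha : ¬ Summable fun x : Est J => f x * -(QZ lam μ r A B f x) * piZ η μ A B x := by
      intro ha
      apply hb
      refine (ha.sub hdiff.summable).congr fun x => ?_
      rw [← key x]; ring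
    rw [tsum_eq_zero_of_not_summable hb, tsum_eq_zero_of_not_summable ha]

end UnrelNet
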